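/- The Coxeter transformation C, regarded as a complex (m+k)×(m+k) matrix, is diagonalizable over ℂ (its Jordan normal form is diagonal) if and only if the symmetric matrix B = [[I, D],[Dᵀ, I]] is invertible, i.e., if and only if the Tits form is non-degenerate. -/

import Mathlib

open Matrix

section Aux

variable {m k : ℕ} (D : Matrix (Fin m) (Fin k) ℂ)

lemma fromBlocks_sub_aux (a a' : Matrix (Fin m) (Fin m) ℂ) (b b' : Matrix (Fin m) (Fin k) ℂ)
    (c c' : Matrix (Fin k) (Fin m) ℂ) (d d' : Matrix (Fin k) (Fin k) ℂ) :
    fromBlocks a b c d - fromBlocks a' b' c' d'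
      = fromBlocks (a - a') (b - b') (c - c') (d - d') := by
  rw [sub_eq_add_neg, fromBlocks_neg, fromBlocks_add]
  simp only [sub_eq_add_neg]

lemma aux_C : fromBlocks (-1) ((-2 : ℂ) • D) 0 1 * fromBlocks 1 0 ((-2 : ℂ) • Dᵀ) (-1)
    = fromBlocks ((4 : ℂ) • (D * Dᵀ) - 1) ((2 : ℂ) • D) ((-2 : ℂ) • Dᵀ) (-1) := by
  rw [fromBlocks_multiply]
  congr 1
  · simp [smul_smul]; norm_num; abel
  · simp
  · simp
  · simp

lemma id1 (C S : Matrix (Fin m ⊕ Fin k) (Fin m ⊕ Fin k) ℂ)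
    (hC : C = fromBlocks (-1) ((-2 : ℂ) • D) 0 1 * fromBlocks 1 0 ((-2 : ℂ) • Dᵀ) (-1))
    (hS : S = fromBlocks 0 D Dᵀ 0) : C * C + 1 = C * ((4 : ℂ) • (S * S) - (2 : ℂ) • 1) := by
  have h1 : (fromBlocks (-1) ((-2 : ℂ) • D) 0 1 : Matrix (Fin m ⊕ Fin k) (Fin m ⊕ Fin k) ℂ) *
      fromBlocks (-1) ((-2 : ℂ) • D) 0 1 = 1 := by
    rw [fromBlocks_multiply, ← fromBlocks_one]; simp
  have h2 : (fromBlocks 1 0 ((-2 : ℂ) • Dᵀ) (-1) : Matrix (Fin m ⊕ Fin k) (Fin m ⊕ Fin k) ℂ) *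
      fromBlocks 1 0 ((-2 : ℂ) • Dᵀ) (-1) = 1 := by
    rw [fromBlocks_multiply, ← fromBlocks_one]; simp
  have h3 : (fromBlocks (-1) ((-2 : ℂ) • D) 0 1 : Matrix (Fin m ⊕ Fin k) (Fin m ⊕ Fin k) ℂ) +
      fromBlocks 1 0 ((-2 : ℂ) • Dᵀ) (-1) = (-2 : ℂ) • S := by
    rw [hS, fromBlocks_add, fromBlocks_smul]; simp
  generalize (fromBlocks (-1) ((-2 : ℂ) • D) 0 1 :
    Matrix (Fin m ⊕ Fin k) (Fin m ⊕ Fin k) ℂ) = a at *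
  generalize (fromBlocks 1 0 ((-2 : ℂ) • Dᵀ) (-1) :
    Matrix (Fin m ⊕ Fin k) (Fin m ⊕ Fin k) ℂ) = b at *
  have h4 : (4 : ℂ) • (S * S) - (2 : ℂ) • 1 = a * b + b * a := by
    have : (4 : ℂ) • (S * S) = (a + b) * (a + b) := by
      rw [h3]; simp [smul_smul]; norm_num
    rw [this, add_mul, mul_add, mul_add, h1, h2, two_smul]; abel
  have h5 : a * b * (b * a) = 1 := by
    rw [mul_assoc, ← mul_assoc b b a, h2, one_mul, h1]
  rw [h4, hC, mul_add, h5]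

lemma id2 (C S : Matrix (Fin m ⊕ Fin k) (Fin m ⊕ Fin k) ℂ)
    (hC : C = fromBlocks (-1) ((-2 : ℂ) • D) 0 1 * fromBlocks 1 0 ((-2 : ℂ) • Dᵀ) (-1))
    (hS : S = fromBlocks 0 D Dᵀ 0) : C = fromBlocks ((2 : ℂ) • 1) ((4 : ℂ) • D) 0 ((-2 : ℂ) • 1) * S - 1 := by
  rw [hC, aux_C, hS, fromBlocks_multiply, ← fromBlocks_one, fromBlocks_sub_aux]
  congr 1 <;> simp

lemma id3 (C B : Matrix (Fin m ⊕ Fin k) (Fin m ⊕ Fin k) ℂ)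
    (hC : C = fromBlocks (-1) ((-2 : ℂ) • D) 0 1 * fromBlocks 1 0 ((-2 : ℂ) • Dᵀ) (-1))
    (hB : B = fromBlocks 1 D Dᵀ 1) :
    C - 1 = fromBlocks ((-2 : ℂ) • 1) ((4 : ℂ) • D) 0 ((-2 : ℂ) • 1) * B := by
  rw [hC, aux_C, hB, fromBlocks_multiply, ← fromBlocks_one, fromBlocks_sub_aux]
  congr 1
  · simp [two_smul]; abel
  · simp; module
  · simp
  · simp [two_smul]; abel

lemma id4 (B J : Matrix (Fin m ⊕ Fin k) (Fin m ⊕ Fin k) ℂ)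
    (hB : B = fromBlocks 1 D Dᵀ 1) (hJ : J = fromBlocks 1 0 0 (-1)) :
    B * J = J * ((2 : ℂ) • 1 - B) := by
  rw [hB, hJ, ← fromBlocks_one, fromBlocks_smul, fromBlocks_sub_aux, fromBlocks_multiply,
    fromBlocks_multiply]
  congr 1 <;> simp [two_smul]

lemma id5 (B J : Matrix (Fin m ⊕ Fin k) (Fin m ⊕ Fin k) ℂ)
    (hB : B = fromBlocks 1 D Dᵀ 1) (hJ : J = fromBlocks 1 0 0 (-1)) :
    fromBlocks ((-2 : ℂ) • 1) ((4 : ℂ) • D) 0 ((-2 : ℂ) • 1) * J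
      = (2 : ℂ) • 1 + fromBlocks ((-4 : ℂ) • 1) 0 0 0 * B := by
  rw [hB, hJ, ← fromBlocks_one, fromBlocks_smul, fromBlocks_multiply,
    fromBlocks_multiply, fromBlocks_add]
  congr 1
  · simp; module
  · simp
  · simp
  · simp

end Aux

lemma diag_nilp {n : Type*} [Fintype n] [DecidableEq n] (C P : Matrix n n ℂ) (hP : IsUnit P.det)
    (hd : (P⁻¹ * C * P).IsDiag) (u : n → ℂ) (h : (C - 1) *ᵥ ((C - 1) *ᵥ u) = 0) :
    (C - 1) *ᵥ u = 0 := by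
  obtain ⟨e, he⟩ : ∃ e, P⁻¹ * (C - 1) * P = diagonal e := by
    obtain ⟨d, hd⟩ := (isDiag_iff_diagonal_diag _).1 hd ▸ (⟨_, rfl⟩ : ∃ d, P⁻¹ * C * P = d)
    refine ⟨fun i => (P⁻¹ * C * P).diag i - 1, ?_⟩
    have h0 := (isDiag_iff_diagonal_diag _).1 ‹(P⁻¹ * C * P).IsDiag›
    rw [mul_sub, sub_mul, mul_one, nonsing_inv_mul _ hP, ← diagonal_sub, h0, diagonal_one]
  have hC : C - 1 = P * diagonal e * P⁻¹ := by
    rw [← he, ← mul_assoc, ← mul_assoc, mul_nonsing_inv _ hP, one_mul, mul_assoc,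
      mul_nonsing_inv _ hP, mul_one]
  have h2 : diagonal e *ᵥ (diagonal e *ᵥ (P⁻¹ *ᵥ u)) = 0 := by
    have : P⁻¹ *ᵥ ((C - 1) *ᵥ ((C - 1) *ᵥ u)) = 0 := by rw [h, mulVec_zero]
    rw [← this, hC]
    simp only [mulVec_mulVec]
    congr 1
    simp only [mul_assoc]
    rw [← mul_assoc P⁻¹ P, ← mul_assoc P⁻¹ P, nonsing_inv_mul _ hP, one_mul, one_mul]
  have h3 : diagonal e *ᵥ (P⁻¹ *ᵥ u) = 0 := by
    ext i
    have := congrFun h2 i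
    simp only [mulVec_diagonal, Pi.zero_apply] at this ⊢
    rcases mul_eq_zero.1 this with h | h
    · rw [h, zero_mul]
    · exact h
  rw [hC, ← mulVec_mulVec, ← mulVec_mulVec, h3, mulVec_zero]

lemma diag_of_span {n : Type*} [Fintype n] [DecidableEq n] (C : Matrix n n ℂ)
    (h : Submodule.span ℂ {v : n → ℂ | ∃ μ : ℂ, C *ᵥ v = μ • v} = ⊤) :
    ∃ P : Matrix n n ℂ, IsUnit P.det ∧ (P⁻¹ * C * P).IsDiag := by
  let b0 := Module.Basis.ofSpan h.ge
  have hb0 : ∀ i, ∃ μ : ℂ, C *ᵥ (b0 i) = μ • b0 i := fun i =>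
    Module.Basis.ofSpan_subset h.ge ⟨i, rfl⟩
  let b := b0.reindex (b0.indexEquiv (Pi.basisFun ℂ n))
  have hb : ∀ i, ∃ μ : ℂ, C *ᵥ (b i) = μ • b i := fun i => by
    simp only [b, Module.Basis.reindex_apply]; exact hb0 _
  choose μ hμ using hb
  have hP : IsUnit ((Pi.basisFun ℂ n).toMatrix b).det := by
    rw [← Module.Basis.det_apply]
    exact Module.Basis.isUnit_det _ _
  refine ⟨(Pi.basisFun ℂ n).toMatrix b, hP, ?_⟩
  have : C * (Pi.basisFun ℂ n).toMatrix b = (Pi.basisFun ℂ n).toMatrix b * diagonal μ := by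
    ext i j
    have := congrFun (hμ j) i
    rw [mul_diagonal]
    simp only [Matrix.mul_apply, Module.Basis.toMatrix_apply, Pi.basisFun_repr]
    simp only [mulVec, dotProduct, Pi.smul_apply, smul_eq_mul] at this
    rw [this, mul_comm]
  rw [mul_assoc, this, ← mul_assoc, nonsing_inv_mul _ hP, one_mul]
  exact isDiag_diagonal μ

/-- A vector killed by a separable quadratic in `C` is a sum of eigenvectors. -/
lemma mem_of_quad {n : Type*} [Fintype n] [DecidableEq n] (C : Matrix n n ℂ) (v : n → ℂ) (t : ℂ)
    (ht : t ^ 2 ≠ 4) (h : C *ᵥ (C *ᵥ v) = t • (C *ᵥ v) - v) :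
    v ∈ Submodule.span ℂ {v : n → ℂ | ∃ μ : ℂ, C *ᵥ v = μ • v} := by
  obtain ⟨r, hr⟩ := IsAlgClosed.exists_pow_nat_eq (t ^ 2 - 4) (n := 2) (by norm_num)
  have hr0 : r ≠ 0 := by
    rintro rfl
    apply ht
    linear_combination -hr
  have key : ∀ p q : ℂ, p + q = t → p * q = 1 →
      C *ᵥ v - q • v ∈ Submodule.span ℂ {v : n → ℂ | ∃ μ : ℂ, C *ᵥ v = μ • v} := by
    intro p q h1 h2
    apply Submodule.subset_span
    refine ⟨p, ?_⟩
    rw [mulVec_sub, mulVec_smul, h]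
    ext i
    simp only [Pi.sub_apply, Pi.smul_apply, smul_eq_mul]
    linear_combination (-(C *ᵥ v) i) * h1 + v i * h2
  have k1 := key ((t + r) / 2) ((t - r) / 2) (by ring) (by linear_combination -hr / 4)
  have k2 := key ((t - r) / 2) ((t + r) / 2) (by ring) (by linear_combination -hr / 4)
  have := Submodule.smul_mem _ r⁻¹ (Submodule.sub_mem _ k1 k2)
  convert this using 1
  ext i
  simp only [Pi.sub_apply, Pi.smul_apply, smul_eq_mul]
  field_simp
  ring

theorem main_C (m k : ℕ) (D : Matrix (Fin m) (Fin k) ℂ) (hD : Dᴴ = Dᵀ)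
    (C : Matrix (Fin m ⊕ Fin k) (Fin m ⊕ Fin k) ℂ)
    (hC : C = fromBlocks (-1) ((-2 : ℂ) • D) 0 1 * fromBlocks 1 0 ((-2 : ℂ) • Dᵀ) (-1))
    (B : Matrix (Fin m ⊕ Fin k) (Fin m ⊕ Fin k) ℂ)
    (hB : B = fromBlocks 1 D Dᵀ 1) :
    (∃ P : Matrix (Fin m ⊕ Fin k) (Fin m ⊕ Fin k) ℂ,
        IsUnit P.det ∧ (P⁻¹ * C * P).IsDiag)
      ↔ IsUnit B.det := by
  obtain ⟨J, hJ⟩ : ∃ J : Matrix (Fin m ⊕ Fin k) (Fin m ⊕ Fin k) ℂ, J = fromBlocks 1 0 0 (-1) :=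
    ⟨_, rfl⟩
  obtain ⟨S, hS⟩ : ∃ S : Matrix (Fin m ⊕ Fin k) (Fin m ⊕ Fin k) ℂ, S = fromBlocks 0 D Dᵀ 0 :=
    ⟨_, rfl⟩
  have i1 := id1 D C S hC hS
  have i2 := id2 D C S hC hS
  have i3 := id3 D C B hC hB
  have i4 := id4 D B J hB hJ
  have i5 := id5 D B J hB hJ
  have hBS : B = 1 + S := by rw [hB, hS, ← fromBlocks_one, fromBlocks_add]; simp
  have hJJ : J * J = 1 := by rw [hJ, ← fromBlocks_one, fromBlocks_multiply]; simp
  constructor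
  · rintro ⟨P, hP, hd⟩
    by_contra hu
    have hdet : B.det = 0 := by simpa using hu
    obtain ⟨v, hv0, hv⟩ := exists_mulVec_eq_zero_iff.2 hdet
    have hCv : (C - 1) *ᵥ v = 0 := by rw [i3, ← mulVec_mulVec, hv, mulVec_zero]
    have hCJ : (C - 1) *ᵥ (J *ᵥ v) = (4 : ℂ) • v := by
      rw [i3, ← mulVec_mulVec, mulVec_mulVec (M := B), i4, ← mulVec_mulVec, sub_mulVec, hv,
        smul_mulVec, one_mulVec, sub_zero, mulVec_smul, mulVec_smul, mulVec_mulVec, i5,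
        add_mulVec, ← mulVec_mulVec, hv, mulVec_zero, smul_mulVec, one_mulVec, add_zero,
        smul_smul]
      norm_num
    have := diag_nilp C P hP hd (J *ᵥ v) (by rw [hCJ, mulVec_smul, hCv, smul_zero])
    rw [hCJ] at this
    exact hv0 ((smul_eq_zero.1 this).resolve_left (by norm_num))
  · intro hu
    apply diag_of_span
    have hinj : ∀ v, B *ᵥ v = 0 → v = 0 := fun v hv => by
      by_contra h0
      exact hu.ne_zero (exists_mulVec_eq_zero_iff.1 ⟨v, h0, hv⟩)
    have hH : S.IsHermitian := by
      have hD' : Dᵀᴴ = D := by rw [← hD, conjTranspose_conjTranspose]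
      rw [hS, IsHermitian, fromBlocks_conjTranspose, hD, hD']; simp
    have heig : ∀ (v : Fin m ⊕ Fin k → ℂ) (s : ℂ), v ≠ 0 → S *ᵥ v = s • v →
        v ∈ Submodule.span ℂ {v : Fin m ⊕ Fin k → ℂ | ∃ μ : ℂ, C *ᵥ v = μ • v} := by
      intro v s hv0 hs
      by_cases h0 : s = 0
      · apply Submodule.subset_span
        refine ⟨-1, ?_⟩
        rw [i2, sub_mulVec, ← mulVec_mulVec, hs, h0]; simp
      · have hBv : B *ᵥ v = (1 + s) • v := by
          rw [hBS, add_mulVec, one_mulVec, hs, add_smul, one_smul]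
        apply mem_of_quad C v (4 * s ^ 2 - 2)
        · intro h
          have : s ^ 2 * ((s - 1) * (s + 1)) = 0 := by linear_combination h / 16
          rcases mul_eq_zero.1 this with h | h
          · exact h0 (by simpa using h)
          rcases mul_eq_zero.1 h with h | h
          · have hJv : B *ᵥ (J *ᵥ v) = 0 := by
              rw [mulVec_mulVec, i4, ← mulVec_mulVec, sub_mulVec, hBv, smul_mulVec, one_mulVec,
                ← sub_smul, show (2 : ℂ) - (1 + s) = 0 by linear_combination -h, zero_smul,
                mulVec_zero]
            have h2 := hinj _ hJv
            apply hv0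
            rw [← one_mulVec v, ← hJJ, ← mulVec_mulVec, h2, mulVec_zero]
          · exact hv0 (hinj v (by rw [hBv, add_comm, h, zero_smul]))
        · have h1 := congrArg (· *ᵥ v) i1
          simp only [add_mulVec, one_mulVec, ← mulVec_mulVec, sub_mulVec, smul_mulVec, hs,
            mulVec_smul, smul_smul, ← sub_smul] at h1
          rw [eq_sub_iff_add_eq, h1]
          congr 1; ring
    rw [eq_top_iff]
    rintro v -
    have hsum := hH.eigenvectorBasis.sum_repr (WithLp.toLp 2 v)
    have hv : v = ∑ i, hH.eigenvectorBasis.repr (WithLp.toLp 2 v) i •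
        (hH.eigenvectorBasis i).ofLp := by
      have := congrArg WithLp.ofLp hsum
      simpa using this.symm
    rw [hv]
    refine Submodule.sum_mem _ fun i _ => Submodule.smul_mem _ _ ?_
    refine heig _ (hH.eigenvalues i : ℂ) ?_ ?_
    · intro h
      exact hH.eigenvectorBasis.toBasis.ne_zero i (by simpa using h)
    · rw [hH.mulVec_eigenvectorBasis i]; ext; simp

/-- The Coxeter transformation `C` (with `F = Dᵀ`), regarded as a complex
matrix, is diagonalizable over ℂ if and only if the symmetric matrix `B = [[I,D],[Dᵀ,I]]`
of the Tits form is invertible. -/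
theorem stmt_8 (m k : ℕ) (hm : 0 < m) (hk : 0 < k)
    (D : Matrix (Fin m) (Fin k) ℝ)
    (C : Matrix (Fin m ⊕ Fin k) (Fin m ⊕ Fin k) ℝ)
    (hC : C = fromBlocks (-1) ((-2 : ℝ) • D) 0 1 * fromBlocks 1 0 ((-2 : ℝ) • Dᵀ) (-1))
    (B : Matrix (Fin m ⊕ Fin k) (Fin m ⊕ Fin k) ℝ)
    (hB : B = fromBlocks 1 D Dᵀ 1) :
    (∃ P : Matrix (Fin m ⊕ Fin k) (Fin m ⊕ Fin k) ℂ,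
        IsUnit P.det ∧ (P⁻¹ * C.map Complex.ofReal * P).IsDiag)
      ↔ IsUnit B.det := by
  have hdet : (B.map Complex.ofReal).det = (B.det : ℂ) :=
    (RingHom.map_det Complex.ofRealHom B).symm
  have h1 : (1 : Matrix (Fin m) (Fin m) ℝ).map Complex.ofReal = 1 :=
    Matrix.map_one _ (by simp) (by simp)
  have h1' : (1 : Matrix (Fin k) (Fin k) ℝ).map Complex.ofReal = 1 :=
    Matrix.map_one _ (by simp) (by simp)
  have hn : (-1 : Matrix (Fin m) (Fin m) ℝ).map Complex.ofReal = -1 := by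
    rw [← h1]; ext i j; simp only [map_apply, Matrix.neg_apply, Complex.ofReal_neg]
  have hn' : (-1 : Matrix (Fin k) (Fin k) ℝ).map Complex.ofReal = -1 := by
    rw [← h1']; ext i j; simp only [map_apply, Matrix.neg_apply, Complex.ofReal_neg]
  rw [main_C m k (D.map Complex.ofReal) (by ext; simp) (C.map Complex.ofReal) ?_
    (B.map Complex.ofReal) ?_, hdet]
  · simp
  · have key : ∀ X Y : Matrix (Fin m ⊕ Fin k) (Fin m ⊕ Fin k) ℝ,
        (X * Y).map Complex.ofReal = X.map Complex.ofReal * Y.map Complex.ofReal := fun X Y =>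
      Matrix.map_mul (f := Complex.ofRealHom)
    rw [hC, key]
    rw [fromBlocks_map, fromBlocks_map, hn, hn', h1, h1']
    congr 2
    · ext; simp
    · ext; simp
  · rw [hB, fromBlocks_map, h1, h1', transpose_map]
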